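/- Let n, m be positive integers, let Â ∈ ℝ^{n×n} have spectral radius strictly less than 1, let B ∈ ℝ^{n×m}, and let γ > 0. Define the energy-to-energy gain γ_ee as the supremum, over all sequences n : ℕ → ℝ^m with Σ_{k=0}^∞ ‖n[k]‖₂² ≤ 1, of (Σ_{k=0}^∞ ‖x[k]‖₂²)^{1/2}, where x[0] = 0 and x[k+1] = Â x[k] + B n[k] for all k. Then γ_ee < γ if and only if there exists a symmetric positive definite matrix 𝒳 ∈ ℝ^{n×n} such that the block matrix [[𝒳, 0],[0, γ² I_n]] − [[Â, B],[I_n, 0]] · [[𝒳, 0],[0, I_m]] · [[Â, B],[I_n, 0]]ᵀ is positive definite. -/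

import Mathlib

open Matrix

section Duality

variable {ι κ : Type*} [Fintype ι] [Fintype κ] [DecidableEq ι] [DecidableEq κ]

lemma posDef_inv_sub_of_posDef_sub {D : Matrix ι ι ℝ} {E : Matrix κ κ ℝ} (M : Matrix ι κ ℝ)
    (hD : D.PosDef) (hE : E.PosDef) (h : (E - Mᵀ * D * M).PosDef) :
    (D⁻¹ - M * E⁻¹ * Mᵀ).PosDef := by
  have hDt : Dᵀ = D := by simpa using hD.isHermitian.eq
  have hEt : Eᵀ = E := by simpa using hE.isHermitian.eq
  have hDu : IsUnit D.det := (Matrix.isUnit_iff_isUnit_det _).1 hD.isUnit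
  have hEu : IsUnit E.det := (Matrix.isUnit_iff_isUnit_det _).1 hE.isUnit
  refine PosDef.of_dotProduct_mulVec_pos ?_ fun v hv => ?_
  · simp [Matrix.IsHermitian, Matrix.transpose_nonsing_inv, hDt, hEt, Matrix.mul_assoc]
  set u := E⁻¹ *ᵥ (Mᵀ *ᵥ v) with hu
  have hEu' : E *ᵥ u = Mᵀ *ᵥ v := by
    rw [hu, mulVec_mulVec, Matrix.mul_nonsing_inv _ hEu, one_mulVec]
  have hquad : star v ⬝ᵥ (D⁻¹ - M * E⁻¹ * Mᵀ) *ᵥ v = v ⬝ᵥ D⁻¹ *ᵥ v - v ⬝ᵥ M *ᵥ u := by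
    rw [star_trivial, sub_mulVec, dotProduct_sub, hu, mulVec_mulVec, mulVec_mulVec, Matrix.mul_assoc]
  have hvu : v ⬝ᵥ M *ᵥ u = u ⬝ᵥ E *ᵥ u := by
    rw [hEu', dotProduct_mulVec, ← mulVec_transpose, dotProduct_comm]
  rw [hquad]
  by_cases hu0 : u = 0
  · simpa [hu0] using hD.inv.dotProduct_mulVec_pos hv
  have hlt := h.dotProduct_mulVec_pos hu0
  have hsq := hD.inv.posSemidef.dotProduct_mulVec_nonneg (v - D *ᵥ (M *ᵥ u))
  have hDD : D⁻¹ *ᵥ (D *ᵥ (M *ᵥ u)) = M *ᵥ u := by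
    rw [mulVec_mulVec, Matrix.nonsing_inv_mul _ hDu, one_mulVec]
  have hcross : (D *ᵥ (M *ᵥ u)) ⬝ᵥ (D⁻¹ *ᵥ v) = v ⬝ᵥ M *ᵥ u := by
    rw [dotProduct_mulVec, ← mulVec_transpose, Matrix.transpose_nonsing_inv, hDt, hDD,
      dotProduct_comm]
  have hmid : u ⬝ᵥ (Mᵀ * D * M) *ᵥ u = (D *ᵥ (M *ᵥ u)) ⬝ᵥ (M *ᵥ u) := by
    rw [Matrix.mul_assoc, ← mulVec_mulVec, dotProduct_mulVec, vecMul_transpose, ← mulVec_mulVec,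
      dotProduct_comm]
  rw [star_trivial, sub_mulVec, dotProduct_sub, hmid] at hlt
  rw [star_trivial, mulVec_sub, hDD, sub_dotProduct, dotProduct_sub, dotProduct_sub, hcross] at hsq
  linarith

omit [DecidableEq ι] [DecidableEq κ] in
lemma posDef_fromBlocks_diagonal {D : Matrix ι ι ℝ} {E : Matrix κ κ ℝ}
    (hD : D.PosDef) (hE : E.PosDef) : (fromBlocks D 0 0 E).PosDef := by
  refine PosDef.of_dotProduct_mulVec_pos
    (IsHermitian.fromBlocks hD.isHermitian (by simp) hE.isHermitian) fun v hv => ?_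
  obtain ⟨x, y, rfl⟩ : ∃ x y, v = Sum.elim x y := ⟨v ∘ Sum.inl, v ∘ Sum.inr, by simp⟩
  have hD0 := hD.posSemidef.dotProduct_mulVec_nonneg x
  have hE0 := hE.posSemidef.dotProduct_mulVec_nonneg y
  simp only [star_trivial] at hD0 hE0 ⊢
  simp only [fromBlocks_mulVec, zero_mulVec, Sum.elim_comp_inl, Sum.elim_comp_inr, zero_add,
    add_zero, sumElim_dotProduct_sumElim]
  by_cases hx : x = 0
  · have hy : y ≠ 0 := by
      rintro rfl
      exact hv (by subst hx; ext (i | i) <;> rfl)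
    have := hE.dotProduct_mulVec_pos hy
    simp only [star_trivial] at this
    linarith
  · have := hD.dotProduct_mulVec_pos hx
    simp only [star_trivial] at this
    linarith

lemma inv_fromBlocks_diagonal {D : Matrix ι ι ℝ} {E : Matrix κ κ ℝ}
    (hD : IsUnit D) (hE : IsUnit E) :
    (fromBlocks D 0 0 E)⁻¹ = fromBlocks D⁻¹ 0 0 E⁻¹ := by
  refine Matrix.inv_eq_right_inv ?_
  simp [fromBlocks_multiply, Matrix.mul_nonsing_inv _ ((Matrix.isUnit_iff_isUnit_det _).1 hD),
    Matrix.mul_nonsing_inv _ ((Matrix.isUnit_iff_isUnit_det _).1 hE)]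

lemma inv_smul_one {c : ℝ} (hc : c ≠ 0) : (c • (1 : Matrix ι ι ℝ))⁻¹ = c⁻¹ • 1 :=
  Matrix.inv_eq_right_inv (by simp [smul_smul, hc])

/-- The dual form of the bounded real inequality for the system `x⁺ = A x + B w`, `y = x` is
equivalent to its primal form for the inverse matrix. -/
lemma posDef_dual_iff_primal (A : Matrix ι ι ℝ) (B : Matrix ι κ ℝ) {c : ℝ} (hc : 0 < c)
    {X : Matrix ι ι ℝ} (hX : X.PosDef) :
    (fromBlocks X 0 0 (c • (1 : Matrix ι ι ℝ)) -
      fromBlocks A B (1 : Matrix ι ι ℝ) (0 : Matrix ι κ ℝ) *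
        fromBlocks X 0 0 (1 : Matrix κ κ ℝ) *
        (fromBlocks A B (1 : Matrix ι ι ℝ) (0 : Matrix ι κ ℝ))ᵀ).PosDef ↔
    (fromBlocks X⁻¹ 0 0 (1 : Matrix κ κ ℝ) -
      (fromBlocks A B (1 : Matrix ι ι ℝ) (0 : Matrix ι κ ℝ))ᵀ *
        fromBlocks X⁻¹ 0 0 (c⁻¹ • (1 : Matrix ι ι ℝ)) *
        fromBlocks A B (1 : Matrix ι ι ℝ) (0 : Matrix ι κ ℝ)).PosDef := by
  have h1 : (c • (1 : Matrix ι ι ℝ)).PosDef := PosDef.one.smul hc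
  have hF : (fromBlocks X 0 0 (c • (1 : Matrix ι ι ℝ))).PosDef := posDef_fromBlocks_diagonal hX h1
  have hG : (fromBlocks X 0 0 (1 : Matrix κ κ ℝ)).PosDef := posDef_fromBlocks_diagonal hX PosDef.one
  have hFi := inv_fromBlocks_diagonal hX.isUnit h1.isUnit
  have hGi := inv_fromBlocks_diagonal (E := (1 : Matrix κ κ ℝ)) hX.isUnit isUnit_one
  rw [inv_smul_one hc.ne'] at hFi
  rw [inv_one] at hGi
  rw [← hFi, ← hGi]
  constructor
  · intro h
    simpa using posDef_inv_sub_of_posDef_sub (fromBlocks A B 1 0)ᵀ hG hF (by simpa using h)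
  · intro h
    have := posDef_inv_sub_of_posDef_sub (fromBlocks A B 1 0) hF.inv hG.inv h
    rwa [Matrix.nonsing_inv_nonsing_inv _ ((Matrix.isUnit_iff_isUnit_det _).1 hF.isUnit),
      Matrix.nonsing_inv_nonsing_inv _ ((Matrix.isUnit_iff_isUnit_det _).1 hG.isUnit)] at this

lemma dotProduct_primal_mulVec (A : Matrix ι ι ℝ) (B : Matrix ι κ ℝ) (c : ℝ) (P : Matrix ι ι ℝ)
    (x : ι → ℝ) (w : κ → ℝ) :
    Sum.elim x w ⬝ᵥ (fromBlocks P 0 0 (1 : Matrix κ κ ℝ) -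
      (fromBlocks A B (1 : Matrix ι ι ℝ) (0 : Matrix ι κ ℝ))ᵀ *
        fromBlocks P 0 0 (c • (1 : Matrix ι ι ℝ)) *
        fromBlocks A B (1 : Matrix ι ι ℝ) (0 : Matrix ι κ ℝ)) *ᵥ Sum.elim x w =
    x ⬝ᵥ P *ᵥ x + w ⬝ᵥ w - (A *ᵥ x + B *ᵥ w) ⬝ᵥ P *ᵥ (A *ᵥ x + B *ᵥ w) - c * (x ⬝ᵥ x) := by
  rw [sub_mulVec, dotProduct_sub, Matrix.mul_assoc, ← mulVec_mulVec,
    dotProduct_mulVec (Sum.elim x w) (_ᵀ), vecMul_transpose, ← mulVec_mulVec]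
  simp only [fromBlocks_mulVec, zero_mulVec, Sum.elim_comp_inl, Sum.elim_comp_inr, zero_add,
    add_zero, sumElim_dotProduct_sumElim, one_mulVec, smul_mulVec, dotProduct_smul, smul_eq_mul]
  ring

end Duality

section Coercive
variable {ι : Type*} [Fintype ι]

lemma dotProduct_self_nonneg_real (v : ι → ℝ) : 0 ≤ v ⬝ᵥ v := by
  simpa using dotProduct_star_self_nonneg v

lemma dotProduct_self_pos {v : ι → ℝ} (hv : v ≠ 0) : 0 < v ⬝ᵥ v := by
  simpa using dotProduct_star_self_pos_iff.2 hv

lemma exists_forall_mul_dotProduct_le {N : Matrix ι ι ℝ} (hN : N.PosDef) :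
    ∃ ε > 0, ∀ v : ι → ℝ, ε * (v ⬝ᵥ v) ≤ v ⬝ᵥ N *ᵥ v := by
  rcases isEmpty_or_nonempty ι with hι | hι
  · exact ⟨1, one_pos, fun v => by simp [dotProduct]⟩
  have hne : ∀ v ∈ Metric.sphere (0 : ι → ℝ) 1, v ≠ 0 := fun v hv h0 => by
    simp [h0] at hv
  have hcont : ContinuousOn (fun v : ι → ℝ => (v ⬝ᵥ N *ᵥ v) / (v ⬝ᵥ v)) (Metric.sphere 0 1) := by
    refine ContinuousOn.div (by fun_prop) (by fun_prop) fun v hv =>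
      (dotProduct_self_pos (hne v hv)).ne'
  obtain ⟨v₀, hv₀, hmin⟩ := (isCompact_sphere (0 : ι → ℝ) 1).exists_isMinOn
    (NormedSpace.sphere_nonempty.2 zero_le_one) hcont
  refine ⟨_, div_pos (by simpa using hN.dotProduct_mulVec_pos (hne v₀ hv₀))
    (dotProduct_self_pos (hne v₀ hv₀)),
    fun v => ?_⟩
  by_cases hv : v = 0
  · simp [hv]
  rw [← le_div_iff₀ (dotProduct_self_pos hv)]
  have hn : ‖v‖ ≠ 0 := norm_ne_zero_iff.2 hv
  have h := hmin (show ‖v‖⁻¹ • v ∈ Metric.sphere (0 : ι → ℝ) 1 by simp [norm_smul, hn])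
  simp only [Set.mem_ofPred_eq, mulVec_smul, smul_dotProduct, dotProduct_smul, smul_eq_mul] at h
  rwa [mul_div_mul_left _ _ (inv_ne_zero hn), mul_div_mul_left _ _ (inv_ne_zero hn)] at h

lemma dotProduct_self_le_card_mul_sq_norm (v : ι → ℝ) :
    v ⬝ᵥ v ≤ Fintype.card ι * ‖v‖ ^ 2 := by
  calc v ⬝ᵥ v = ∑ i, ‖v i‖ ^ 2 := by simp [dotProduct, sq]
    _ ≤ ∑ _i : ι, ‖v‖ ^ 2 := by gcongr with i; exact norm_le_pi_norm v i
    _ = _ := by simp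

lemma sq_norm_le_dotProduct_self (v : ι → ℝ) : ‖v‖ ^ 2 ≤ v ⬝ᵥ v := by
  have h0 : 0 ≤ v ⬝ᵥ v := dotProduct_self_nonneg_real v
  refine (Real.le_sqrt (norm_nonneg _) h0).1 ((pi_norm_le_iff_of_nonneg (Real.sqrt_nonneg _)).2
    fun i => Real.le_sqrt_of_sq_le ?_)
  calc ‖v i‖ ^ 2 = v i * v i := by simp [sq]
    _ ≤ v ⬝ᵥ v := Finset.single_le_sum (f := fun i => v i * v i)
      (fun j _ => mul_self_nonneg _) (Finset.mem_univ i)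

end Coercive

section Stability

variable {ι κ : Type*} [Fintype ι] [Fintype κ] [DecidableEq ι]

attribute [local instance] Matrix.linftyOpNormedAddCommGroup Matrix.linftyOpNormedRing
  Matrix.linftyOpNormedAlgebra

lemma exists_norm_pow_le_of_spectrum [Nonempty ι] (A : Matrix ι ι ℝ)
    (hA : ∀ μ ∈ spectrum ℂ (A.map (algebraMap ℝ ℂ)), ‖μ‖ < 1) :
    ∃ ρ : ℝ, 0 < ρ ∧ ρ < 1 ∧ ∃ N : ℕ, 0 < N ∧ ‖A ^ N‖ ≤ ρ ^ N := by
  set a : Matrix ι ι ℂ := A.map (algebraMap ℝ ℂ) with ha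
  have hlt : spectralRadius ℂ a < (1 : NNReal) :=
    spectrum.spectralRadius_lt_of_forall_lt a fun z hz => by exact_mod_cast hA z hz
  obtain ⟨r, hr, hr1⟩ := ENNReal.lt_iff_exists_nnreal_btwn.1 hlt
  have hev := (spectrum.pow_nnnorm_pow_one_div_tendsto_nhds_spectralRadius a).eventually_lt_const hr
  obtain ⟨N, hN, hN0⟩ := (hev.and (Filter.eventually_gt_atTop 0)).exists
  refine ⟨r, by exact_mod_cast (zero_le (a := spectralRadius ℂ a)).trans_lt hr,
    by exact_mod_cast hr1, N, hN0, ?_⟩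
  have hnorm : ‖a ^ N‖₊ = ‖A ^ N‖₊ := by
    have : a ^ N = (A ^ N).map (algebraMap ℝ ℂ) :=
      (map_pow (algebraMap ℝ ℂ).mapMatrix A N).symm
    rw [this]
    simp [Matrix.linfty_opNNNorm_def]
  have h := ENNReal.rpow_le_rpow hN.le (Nat.cast_nonneg (α := ℝ) N)
  rw [← ENNReal.rpow_mul, one_div_mul_cancel (by exact_mod_cast hN0.ne'), ENNReal.rpow_one,
    ENNReal.rpow_natCast, hnorm] at h
  exact_mod_cast h

lemma exists_contracting_norm [Nonempty ι] (A : Matrix ι ι ℝ)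
    (hA : ∀ μ ∈ spectrum ℂ (A.map (algebraMap ℝ ℂ)), ‖μ‖ < 1) :
    ∃ (ρ c : ℝ) (f : (ι → ℝ) → ℝ), 0 < ρ ∧ ρ < 1 ∧ 0 ≤ c ∧ (∀ v, ‖v‖ ≤ f v) ∧
      (∀ v, f v ≤ c * ‖v‖) ∧ (∀ u v, f (u + v) ≤ f u + f v) ∧ ∀ v, f (A *ᵥ v) ≤ ρ * f v := by
  obtain ⟨ρ, hρ0, hρ1, N, hN, hAN⟩ := exists_norm_pow_le_of_spectrum A hA
  obtain ⟨N, rfl⟩ := Nat.exists_eq_succ_of_ne_zero hN.ne'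
  refine ⟨ρ, ∑ k ∈ Finset.range (N + 1), (ρ ^ k)⁻¹ * ‖A ^ k‖,
    fun v => ∑ k ∈ Finset.range (N + 1), (ρ ^ k)⁻¹ * ‖A ^ k *ᵥ v‖, hρ0, hρ1,
    by positivity, fun v => ?_, fun v => ?_, fun u v => ?_, fun v => ?_⟩
  · beta_reduce
    rw [Finset.sum_range_succ']
    simp only [pow_zero, inv_one, one_mul, one_mulVec]
    exact le_add_of_nonneg_left (by positivity)
  · beta_reduce
    rw [Finset.sum_mul]
    refine Finset.sum_le_sum fun k _ => ?_
    rw [mul_assoc]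
    gcongr
    exact linfty_opNorm_mulVec _ _
  · beta_reduce
    rw [← Finset.sum_add_distrib]
    gcongr with k
    rw [← mul_add, mulVec_add]
    gcongr
    exact norm_add_le _ _
  · have hlast : (ρ ^ (N + 1))⁻¹ * ‖A ^ (N + 1) *ᵥ v‖ ≤ ‖v‖ := by
      rw [inv_mul_le_iff₀ (by positivity)]
      exact (linfty_opNorm_mulVec _ _).trans (by gcongr)
    have hshift : ∀ k, (ρ ^ k)⁻¹ * ‖A ^ k *ᵥ (A *ᵥ v)‖ =
        ρ * ((ρ ^ (k + 1))⁻¹ * ‖A ^ (k + 1) *ᵥ v‖) := fun k => by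
      rw [mulVec_mulVec, ← pow_succ, pow_succ ρ]
      field_simp
    simp only [hshift, ← Finset.mul_sum]
    refine mul_le_mul_of_nonneg_left ?_ hρ0.le
    rw [Finset.sum_range_succ, Finset.sum_range_succ' _ N]
    simpa using hlast

/-- A Schur stable linear system has finite energy gain from initial state and input to state. -/
lemma exists_energy_bound [Nonempty ι] (A : Matrix ι ι ℝ) (B : Matrix ι κ ℝ)
    (hA : ∀ μ ∈ spectrum ℂ (A.map (algebraMap ℝ ℂ)), ‖μ‖ < 1) :
    ∃ C : ℝ, 0 ≤ C ∧ ∀ (x : ℕ → ι → ℝ) (w : ℕ → κ → ℝ),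
      (∀ k, x (k + 1) = A *ᵥ x k + B *ᵥ w k) → ∀ K,
      ∑ k ∈ Finset.range K, x k ⬝ᵥ x k ≤
        C * (x 0 ⬝ᵥ x 0 + ∑ k ∈ Finset.range K, w k ⬝ᵥ w k) := by
  obtain ⟨ρ, c, f, hρ0, hρ1, hc, hf1, hf2, hfadd, hfA⟩ := exists_contracting_norm A hA
  have hρ : 0 < 1 - ρ := sub_pos.2 hρ1
  set b := c * ‖B‖ with hb
  set d := b ^ 2 / (1 - ρ) with hd
  have hb0 : 0 ≤ b := mul_nonneg hc (norm_nonneg B)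
  have hd0 : 0 ≤ d := by positivity
  have hf0 : ∀ v, 0 ≤ f v := fun v => (norm_nonneg v).trans (hf1 v)
  refine ⟨Fintype.card ι * (c ^ 2 + d) / (1 - ρ), by positivity, fun x w hx K => ?_⟩
  have hstep : ∀ k, f (x (k + 1)) ^ 2 ≤ ρ * f (x k) ^ 2 + d * (w k ⬝ᵥ w k) := fun k => by
    have h1 : f (x (k + 1)) ≤ ρ * f (x k) + b * ‖w k‖ := by
      rw [hx]
      refine (hfadd _ _).trans (add_le_add (hfA _) ((hf2 _).trans ?_))
      rw [hb, mul_assoc]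
      gcongr
      exact linfty_opNorm_mulVec _ _
    have h2 : f (x (k + 1)) ^ 2 ≤ (ρ * f (x k) + b * ‖w k‖) ^ 2 := by
      gcongr
      exact hf0 _
    have h3 : (ρ * f (x k) + b * ‖w k‖) ^ 2 ≤ ρ * f (x k) ^ 2 + d * ‖w k‖ ^ 2 := by
      have : ρ * f (x k) ^ 2 + d * ‖w k‖ ^ 2 - (ρ * f (x k) + b * ‖w k‖) ^ 2 =
          ρ / (1 - ρ) * ((1 - ρ) * f (x k) - b * ‖w k‖) ^ 2 := by
        rw [hd]; field_simp; ring
      have : 0 ≤ ρ / (1 - ρ) * ((1 - ρ) * f (x k) - b * ‖w k‖) ^ 2 := by positivity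
      linarith
    have h4 := mul_le_mul_of_nonneg_left (sq_norm_le_dotProduct_self (w k)) hd0
    linarith
  have hsum : ∀ K, (1 - ρ) * ∑ k ∈ Finset.range K, f (x k) ^ 2 + f (x K) ^ 2 ≤
      f (x 0) ^ 2 + d * ∑ k ∈ Finset.range K, w k ⬝ᵥ w k := fun K => by
    induction K with
    | zero => simp
    | succ K ih =>
      rw [Finset.sum_range_succ, Finset.sum_range_succ]
      linarith [hstep K]
  have hww : 0 ≤ ∑ k ∈ Finset.range K, w k ⬝ᵥ w k :=
    Finset.sum_nonneg fun k _ => (sq_nonneg _).trans (sq_norm_le_dotProduct_self (w k))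
  have hxx := (sq_nonneg _).trans (sq_norm_le_dotProduct_self (x 0))
  have hinit : f (x 0) ^ 2 ≤ c ^ 2 * (x 0 ⬝ᵥ x 0) := by
    calc f (x 0) ^ 2 ≤ (c * ‖x 0‖) ^ 2 := by
          gcongr
          · exact hf0 _
          · exact hf2 _
      _ = c ^ 2 * ‖x 0‖ ^ 2 := by ring
      _ ≤ _ := by gcongr; exact sq_norm_le_dotProduct_self _
  have hmain : ∑ k ∈ Finset.range K, f (x k) ^ 2 ≤
      (c ^ 2 + d) / (1 - ρ) * (x 0 ⬝ᵥ x 0 + ∑ k ∈ Finset.range K, w k ⬝ᵥ w k) := by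
    rw [div_mul_eq_mul_div, le_div_iff₀ hρ]
    nlinarith [hsum K, sq_nonneg (f (x K)), mul_nonneg hd0 hxx, mul_nonneg (sq_nonneg c) hww]
  calc ∑ k ∈ Finset.range K, x k ⬝ᵥ x k
      ≤ ∑ k ∈ Finset.range K, Fintype.card ι * f (x k) ^ 2 := by
        gcongr with k
        refine (dotProduct_self_le_card_mul_sq_norm _).trans ?_
        gcongr
        exact hf1 _
    _ = Fintype.card ι * ∑ k ∈ Finset.range K, f (x k) ^ 2 := by rw [Finset.mul_sum]
    _ ≤ Fintype.card ι * _ := mul_le_mul_of_nonneg_left hmain (Nat.cast_nonneg _)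
    _ = _ := by ring

end Stability

section Parallelogram

variable {ι : Type*} [Fintype ι] [DecidableEq ι]

/-- A locally bounded function on `ℝⁿ` satisfying the parallelogram law is a quadratic form. -/
lemma exists_matrix_of_parallelogram {V : (ι → ℝ) → ℝ} {C : ℝ}
    (hpar : ∀ x y, V (x + y) + V (x - y) = 2 * V x + 2 * V y)
    (hbd : ∀ x, |V x| ≤ C * (x ⬝ᵥ x)) :
    ∃ P : Matrix ι ι ℝ, Pᵀ = P ∧ ∀ x, V x = x ⬝ᵥ P *ᵥ x := by
  have hV0 : V 0 = 0 := by simpa using hbd 0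
  have heven : ∀ y, V (-y) = V y := fun y => by
    have := hpar 0 y
    simp only [zero_add, zero_sub, hV0] at this
    linarith
  have hflip : ∀ a b, V (a - b) = V (b - a) := fun a b => by rw [← heven, neg_sub]
  set β : (ι → ℝ) → (ι → ℝ) → ℝ := fun x y => (V (x + y) - V (x - y)) / 4 with hβ
  have hsymm : ∀ x y, β x y = β y x := fun x y => by
    simp only [hβ, add_comm x y, hflip x y]
  have hadd : ∀ x z y, β (x + z) y = β x y + β z y := fun x z y => by
    have h1 := hpar (x + y) z
    have h2 := hpar (x - y) z
    have h3 := hpar (z + y) x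
    have h4 := hpar (z - y) x
    have e1 : x + y + z = x + z + y := by abel
    have e2 : x - y + z = x + z - y := by abel
    have e3 : z + y + x = x + z + y := by abel
    have e4 : z - y + x = x + z - y := by abel
    have e5 : V (z + y - x) = V (x - y - z) := by rw [← heven]; congr 1; abel
    have e6 : V (z - y - x) = V (x + y - z) := by rw [← heven]; congr 1; abel
    rw [e1] at h1; rw [e2] at h2; rw [e3, e5] at h3; rw [e4, e6] at h4
    simp only [hβ]
    linarith
  have hsmul : ∀ (c : ℝ) x y, β (c • x) y = c * β x y := fun c x y => by
    let g : ℝ →+ ℝ := AddMonoidHom.mk' (fun t => β (t • x) y) fun s t => by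
      simp only [add_smul, hadd]
    have hg : Continuous g := by
      refine g.continuous_of_isBounded_nhds_zero (Metric.closedBall_mem_nhds 0 one_pos) ?_
      refine isBounded_iff_forall_norm_le.2 ⟨|C| * (x ⬝ᵥ x + y ⬝ᵥ y), ?_⟩
      rintro _ ⟨t, ht, rfl⟩
      have hxx : 0 ≤ x ⬝ᵥ x := dotProduct_self_nonneg_real x
      have hyy : 0 ≤ y ⬝ᵥ y := dotProduct_self_nonneg_real y
      have ht1 : t * t ≤ 1 := by
        have : |t| ≤ 1 := by simpa using ht
        nlinarith [abs_le.1 this]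
      have hdot : (t • x + y) ⬝ᵥ (t • x + y) + (t • x - y) ⬝ᵥ (t • x - y) ≤
          4 * (x ⬝ᵥ x + y ⬝ᵥ y) := by
        simp only [add_dotProduct, dotProduct_add, sub_dotProduct, dotProduct_sub,
          smul_dotProduct, dotProduct_smul, smul_eq_mul]
        nlinarith [mul_le_mul_of_nonneg_right ht1 hxx]
      have h0 : ∀ z : ι → ℝ, |V z| ≤ |C| * (z ⬝ᵥ z) := fun z => (hbd z).trans (by
        have : 0 ≤ z ⬝ᵥ z := dotProduct_self_nonneg_real z
        gcongr
        exact le_abs_self C)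
      have h1 := abs_sub (V (t • x + y)) (V (t • x - y))
      have h2 := mul_le_mul_of_nonneg_left hdot (abs_nonneg C)
      change |(V (t • x + y) - V (t • x - y)) / 4| ≤ _
      rw [abs_div, abs_of_pos (four_pos : (0 : ℝ) < 4), div_le_iff₀ four_pos]
      linarith [h0 (t • x + y), h0 (t • x - y)]
    have := map_real_smul g hg c 1
    simpa [g] using this
  let L : (ι → ℝ) →ₗ[ℝ] (ι → ℝ) →ₗ[ℝ] ℝ := LinearMap.mk₂ ℝ β hadd hsmul
    (fun x y z => by rw [hsymm x, hadd, hsymm y, hsymm z])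
    (fun c x y => by rw [hsymm, hsmul, hsymm y, smul_eq_mul])
  refine ⟨LinearMap.toMatrix₂' ℝ L, ?_, fun x => ?_⟩
  · ext i j
    simp only [transpose_apply, LinearMap.toMatrix₂'_apply]
    exact hsymm _ _
  · rw [← Matrix.toLinearMap₂'_apply', Matrix.toLinearMap₂'_toMatrix']
    change V x = (V (x + x) - V (x - x)) / 4
    have := hpar x x
    rw [sub_self, hV0] at this ⊢
    linarith

end Parallelogram

section Storage

variable {ι κ : Type*} [Fintype ι] [Fintype κ]

/-- The state trajectory of `x⁺ = A x + B w` started at `x₀`. -/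
def stateSeq (A : Matrix ι ι ℝ) (B : Matrix ι κ ℝ) (x₀ : ι → ℝ) (w : ℕ → κ → ℝ) : ℕ → ι → ℝ
  | 0 => x₀
  | k + 1 => A *ᵥ stateSeq A B x₀ w k + B *ᵥ w k

variable (A : Matrix ι ι ℝ) (B : Matrix ι κ ℝ)

lemma eq_stateSeq {x : ℕ → ι → ℝ} {w : ℕ → κ → ℝ}
    (hx : ∀ k, x (k + 1) = A *ᵥ x k + B *ᵥ w k) : x = stateSeq A B (x 0) w := by
  funext k
  induction k with
  | zero => rfl
  | succ k ih => rw [hx, ih, stateSeq]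

lemma stateSeq_add (x y : ι → ℝ) (w v : ℕ → κ → ℝ) (k : ℕ) :
    stateSeq A B (x + y) (w + v) k = stateSeq A B x w k + stateSeq A B y v k := by
  induction k with
  | zero => rfl
  | succ k ih =>
    simp only [stateSeq, ih, Pi.add_apply, mulVec_add]
    abel

lemma stateSeq_smul (c : ℝ) (x : ι → ℝ) (w : ℕ → κ → ℝ) (k : ℕ) :
    stateSeq A B (c • x) (c • w) k = c • stateSeq A B x w k := by
  induction k with
  | zero => rfl
  | succ k ih => simp only [stateSeq, ih, Pi.smul_apply, mulVec_smul, smul_add]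

lemma stateSeq_sub (x y : ι → ℝ) (w v : ℕ → κ → ℝ) (k : ℕ) :
    stateSeq A B (x - y) (w - v) k = stateSeq A B x w k - stateSeq A B y v k := by
  rw [eq_sub_iff_add_eq, ← stateSeq_add, sub_add_cancel, sub_add_cancel]

lemma stateSeq_succ' (x : ι → ℝ) (w : ℕ → κ → ℝ) (k : ℕ) :
    stateSeq A B x w (k + 1) = stateSeq A B (A *ᵥ x + B *ᵥ w 0) (fun j => w (j + 1)) k := by
  induction k with
  | zero => rfl
  | succ k ih => rw [stateSeq, ih, stateSeq]

lemma stateSeq_congr (x : ι → ℝ) {w v : ℕ → κ → ℝ} {K : ℕ} (h : ∀ k < K, w k = v k) :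
    ∀ k ≤ K, stateSeq A B x w k = stateSeq A B x v k := by
  intro k hk
  induction k with
  | zero => rfl
  | succ k ih => rw [stateSeq, stateSeq, ih (by omega), h k (by omega)]

/-- The finite horizon supply `∑_{k < N} (q ‖x k‖² - r ‖w k‖²)` along a trajectory. -/
def cost (q r : ℝ) (N : ℕ) (w : ℕ → κ → ℝ) (x : ι → ℝ) : ℝ :=
  ∑ k ∈ Finset.range N,
    (q * (stateSeq A B x w k ⬝ᵥ stateSeq A B x w k) - r * (w k ⬝ᵥ w k))

variable (q r : ℝ)

lemma cost_add_cost_sub (N : ℕ) (w v : ℕ → κ → ℝ) (x y : ι → ℝ) :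
    cost A B q r N (w + v) (x + y) + cost A B q r N (w - v) (x - y) =
      2 * cost A B q r N w x + 2 * cost A B q r N v y := by
  simp only [cost, ← Finset.sum_add_distrib, Finset.mul_sum]
  refine Finset.sum_congr rfl fun k _ => ?_
  simp only [stateSeq_add, stateSeq_sub, Pi.add_apply, Pi.sub_apply, add_dotProduct,
    dotProduct_add, sub_dotProduct, dotProduct_sub]
  ring

lemma cost_succ (N : ℕ) (w : ℕ → κ → ℝ) (x : ι → ℝ) :
    cost A B q r (N + 1) w x = q * (x ⬝ᵥ x) - r * (w 0 ⬝ᵥ w 0) +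
      cost A B q r N (fun k => w (k + 1)) (A *ᵥ x + B *ᵥ w 0) := by
  rw [cost, Finset.sum_range_succ', add_comm, cost]
  simp only [stateSeq_succ']
  rfl

variable {q r}

lemma exists_cost_le_cost (hq : 0 ≤ q) {N M : ℕ} (hNM : N ≤ M) (w : ℕ → κ → ℝ) (x : ι → ℝ) :
    ∃ v, cost A B q r N w x ≤ cost A B q r M v x := by
  set v : ℕ → κ → ℝ := fun k => if k < N then w k else 0 with hv
  have hvw : ∀ k < N, v k = w k := fun k hk => by simp [hv, hk]
  have heq : cost A B q r N w x = cost A B q r N v x := by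
    refine Finset.sum_congr rfl fun k hk => ?_
    have hk' := Finset.mem_range.1 hk
    rw [stateSeq_congr A B x hvw k hk'.le, hvw k hk']
  refine ⟨v, heq.trans_le ?_⟩
  refine Finset.sum_le_sum_of_subset_of_nonneg (Finset.range_mono hNM) fun k _ hk => ?_
  have hvk : v k = 0 := by simp [hv, Finset.mem_range.not.1 hk]
  rw [hvk]
  simpa using mul_nonneg hq (dotProduct_self_nonneg_real _)

/-- If the available storage is bounded by a multiple of `‖x‖²`, it is a quadratic form that
satisfies the dissipation inequality. -/
lemma exists_storage_matrix [DecidableEq ι] (hq : 0 ≤ q) {C : ℝ}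
    (hC : ∀ N w x, cost A B q r N w x ≤ C * (x ⬝ᵥ x)) :
    ∃ P : Matrix ι ι ℝ, Pᵀ = P ∧ (∀ x, q * (x ⬝ᵥ x) ≤ x ⬝ᵥ P *ᵥ x) ∧
      ∀ x w, q * (x ⬝ᵥ x) - r * (w ⬝ᵥ w) + (A *ᵥ x + B *ᵥ w) ⬝ᵥ P *ᵥ (A *ᵥ x + B *ᵥ w) ≤
        x ⬝ᵥ P *ᵥ x := by
  set V : (ι → ℝ) → ℝ := fun x => ⨆ p : ℕ × (ℕ → κ → ℝ), cost A B q r p.1 p.2 x with hV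
  have hle : ∀ N w x, cost A B q r N w x ≤ V x := fun N w x =>
    le_ciSup (f := fun p : ℕ × (ℕ → κ → ℝ) => cost A B q r p.1 p.2 x)
      ⟨C * (x ⬝ᵥ x), by rintro _ ⟨p, rfl⟩; exact hC _ _ _⟩ (N, w)
  have hVle : ∀ x a, (∀ N w, cost A B q r N w x ≤ a) → V x ≤ a := fun x a h =>
    ciSup_le fun p => h _ _
  have hdiss : ∀ x w, q * (x ⬝ᵥ x) - r * (w ⬝ᵥ w) + V (A *ᵥ x + B *ᵥ w) ≤ V x := fun x w => by
    suffices V (A *ᵥ x + B *ᵥ w) ≤ V x - (q * (x ⬝ᵥ x) - r * (w ⬝ᵥ w)) by linarith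
    refine hVle _ _ fun N v => ?_
    have h := hle (N + 1) (fun k => Nat.casesOn k w v) x
    rw [cost_succ] at h
    change q * (x ⬝ᵥ x) - r * (w ⬝ᵥ w) + cost A B q r N v (A *ᵥ x + B *ᵥ w) ≤ V x at h
    linarith
  have hlow : ∀ x, q * (x ⬝ᵥ x) ≤ V x := fun x => by
    simpa [cost, stateSeq] using hle 1 0 x
  have hjoint : ∀ x y a, (∀ N w v, cost A B q r N w x + cost A B q r N v y ≤ a) →
      V x + V y ≤ a := fun x y a h => by
    suffices V x ≤ a - V y by linarith
    refine hVle _ _ fun N w => ?_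
    suffices V y ≤ a - cost A B q r N w x by linarith
    refine hVle _ _ fun M v => ?_
    obtain ⟨w', hw'⟩ := exists_cost_le_cost A B (r := r) hq (le_max_left N M) w x
    obtain ⟨v', hv'⟩ := exists_cost_le_cost A B (r := r) hq (le_max_right N M) v y
    linarith [h (max N M) w' v']
  have hpar : ∀ x y, V (x + y) + V (x - y) = 2 * V x + 2 * V y := fun x y => by
    apply le_antisymm
    · refine hjoint _ _ _ fun N w v => ?_
      have h := cost_add_cost_sub A B q r N ((1 / 2 : ℝ) • (w + v)) ((1 / 2 : ℝ) • (w - v)) x y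
      have e1 : (1 / 2 : ℝ) • (w + v) + (1 / 2 : ℝ) • (w - v) = w := by module
      have e2 : (1 / 2 : ℝ) • (w + v) - (1 / 2 : ℝ) • (w - v) = v := by module
      rw [e1, e2] at h
      linarith [hle N ((1 / 2 : ℝ) • (w + v)) x, hle N ((1 / 2 : ℝ) • (w - v)) y]
    · suffices V x + V y ≤ (V (x + y) + V (x - y)) / 2 by linarith
      refine hjoint _ _ _ fun N w v => ?_
      linarith [cost_add_cost_sub A B q r N w v x y, hle N (w + v) (x + y),
        hle N (w - v) (x - y)]
  obtain ⟨P, hP, hVP⟩ := exists_matrix_of_parallelogram (C := C) hpar fun x => by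
    rw [abs_of_nonneg ((mul_nonneg hq (dotProduct_self_nonneg_real x)).trans (hlow x))]
    exact hVle _ _ fun N w => hC N w x
  simp only [hVP] at hlow hdiss
  exact ⟨P, hP, hlow, hdiss⟩

lemma add_dotProduct_self_le {η : ℝ} (hη : 0 < η) (z y : ι → ℝ) :
    (z + y) ⬝ᵥ (z + y) ≤ (1 + η⁻¹) * (z ⬝ᵥ z) + (1 + η) * (y ⬝ᵥ y) := by
  have h := mul_nonneg (inv_nonneg.2 hη.le) (dotProduct_self_nonneg_real (z - η • y))
  have e : η⁻¹ * ((z - η • y) ⬝ᵥ (z - η • y)) =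
      η⁻¹ * (z ⬝ᵥ z) - 2 * (z ⬝ᵥ y) + η * (y ⬝ᵥ y) := by
    simp only [sub_dotProduct, dotProduct_sub, smul_dotProduct, dotProduct_smul, smul_eq_mul,
      dotProduct_comm y z]
    field_simp
    ring
  rw [e] at h
  simp only [add_dotProduct, dotProduct_add, dotProduct_comm y z]
  linarith

lemma cost_le_of_gain {C g η : ℝ} (hη : 0 < η) (hq : 0 ≤ q)
    (hC : ∀ (x : ℕ → ι → ℝ) (w : ℕ → κ → ℝ), (∀ k, x (k + 1) = A *ᵥ x k + B *ᵥ w k) → ∀ K,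
      ∑ k ∈ Finset.range K, x k ⬝ᵥ x k ≤ C * (x 0 ⬝ᵥ x 0 + ∑ k ∈ Finset.range K, w k ⬝ᵥ w k))
    (hg : ∀ w K, ∑ k ∈ Finset.range K, stateSeq A B 0 w k ⬝ᵥ stateSeq A B 0 w k ≤
      g ^ 2 * ∑ k ∈ Finset.range K, w k ⬝ᵥ w k)
    (hqr : q * (1 + η) * g ^ 2 ≤ r) (N : ℕ) (w : ℕ → κ → ℝ) (x : ι → ℝ) :
    cost A B q r N w x ≤ q * (1 + η⁻¹) * C * (x ⬝ᵥ x) := by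
  have hz : ∑ k ∈ Finset.range N, stateSeq A B x 0 k ⬝ᵥ stateSeq A B x 0 k ≤ C * (x ⬝ᵥ x) := by
    simpa [stateSeq] using hC (stateSeq A B x 0) 0 (fun _ => rfl) N
  have hsplit : ∀ k, stateSeq A B x w k = stateSeq A B x 0 k + stateSeq A B 0 w k := fun k => by
    rw [← stateSeq_add, add_zero, zero_add]
  have hsum : ∑ k ∈ Finset.range N, stateSeq A B x w k ⬝ᵥ stateSeq A B x w k ≤
      (1 + η⁻¹) * ∑ k ∈ Finset.range N, stateSeq A B x 0 k ⬝ᵥ stateSeq A B x 0 k +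
      (1 + η) * ∑ k ∈ Finset.range N, stateSeq A B 0 w k ⬝ᵥ stateSeq A B 0 w k := by
    rw [Finset.mul_sum, Finset.mul_sum, ← Finset.sum_add_distrib]
    refine Finset.sum_le_sum fun k _ => ?_
    rw [hsplit]
    exact add_dotProduct_self_le hη _ _
  have hw : 0 ≤ ∑ k ∈ Finset.range N, w k ⬝ᵥ w k :=
    Finset.sum_nonneg fun k _ => dotProduct_self_nonneg_real _
  have h1 := mul_le_mul_of_nonneg_left hsum hq
  have h2 := mul_le_mul_of_nonneg_left hz (show 0 ≤ q * (1 + η⁻¹) by positivity)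
  have h3 := mul_le_mul_of_nonneg_left (hg w N) (show 0 ≤ q * (1 + η) by positivity)
  have h4 := mul_le_mul_of_nonneg_right hqr hw
  rw [cost, Finset.sum_sub_distrib, ← Finset.mul_sum, ← Finset.mul_sum]
  linarith

/-- A bound on the response to unit energy disturbances gives finite horizon gain bounds. -/
lemma finite_horizon_gain {C g : ℝ}
    (hC : ∀ (x : ℕ → ι → ℝ) (w : ℕ → κ → ℝ), (∀ k, x (k + 1) = A *ᵥ x k + B *ᵥ w k) → ∀ K,
      ∑ k ∈ Finset.range K, x k ⬝ᵥ x k ≤ C * (x 0 ⬝ᵥ x 0 + ∑ k ∈ Finset.range K, w k ⬝ᵥ w k))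
    (hg : ∀ w : ℕ → κ → ℝ, Summable (fun k => w k ⬝ᵥ w k) → ∑' k, w k ⬝ᵥ w k ≤ 1 →
      ∀ K, ∑ k ∈ Finset.range K, stateSeq A B 0 w k ⬝ᵥ stateSeq A B 0 w k ≤ g ^ 2)
    (w : ℕ → κ → ℝ) (K : ℕ) :
    ∑ k ∈ Finset.range K, stateSeq A B 0 w k ⬝ᵥ stateSeq A B 0 w k ≤
      g ^ 2 * ∑ k ∈ Finset.range K, w k ⬝ᵥ w k := by
  set W := ∑ k ∈ Finset.range K, w k ⬝ᵥ w k with hW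
  have hW0 : 0 ≤ W := Finset.sum_nonneg fun k _ => dotProduct_self_nonneg_real _
  rcases hW0.eq_or_lt with h0 | hpos
  · have := hC (stateSeq A B 0 w) w (fun _ => rfl) K
    rw [← hW, ← h0] at this
    rw [← h0]
    simpa [stateSeq] using this
  set c := (Real.sqrt W)⁻¹ with hc
  have hc2 : c * c * W = 1 := by
    rw [hc, ← mul_inv, Real.mul_self_sqrt hW0, inv_mul_cancel₀ hpos.ne']
  set v : ℕ → κ → ℝ := fun k => if k < K then (c • w) k else 0 with hv
  have hvw : ∀ k < K, v k = (c • w) k := fun k hk => by simp [hv, hk]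
  have hsum : HasSum (fun k => v k ⬝ᵥ v k) 1 := by
    have h : HasSum (fun k => v k ⬝ᵥ v k) (∑ k ∈ Finset.range K, v k ⬝ᵥ v k) :=
      hasSum_sum_of_ne_finset_zero fun k hk => by simp [hv, Finset.mem_range.not.1 hk]
    convert h using 1
    rw [← hc2, hW, Finset.mul_sum]
    refine Finset.sum_congr rfl fun k hk => ?_
    rw [hvw k (Finset.mem_range.1 hk), Pi.smul_apply, smul_dotProduct, dotProduct_smul,
      smul_eq_mul, smul_eq_mul, mul_assoc]
  have h := hg v hsum.summable hsum.tsum_eq.le K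
  have hstate : ∑ k ∈ Finset.range K, stateSeq A B 0 v k ⬝ᵥ stateSeq A B 0 v k =
      c * c * ∑ k ∈ Finset.range K, stateSeq A B 0 w k ⬝ᵥ stateSeq A B 0 w k := by
    rw [Finset.mul_sum]
    refine Finset.sum_congr rfl fun k hk => ?_
    have hs := stateSeq_smul A B c 0 w k
    rw [smul_zero] at hs
    rw [stateSeq_congr A B 0 hvw k (Finset.mem_range.1 hk).le, hs, smul_dotProduct,
      dotProduct_smul, smul_eq_mul, smul_eq_mul, mul_assoc]
  rw [hstate] at h
  have h5 := mul_le_mul_of_nonneg_right h hW0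
  calc _ = c * c * W * ∑ k ∈ Finset.range K, stateSeq A B 0 w k ⬝ᵥ stateSeq A B 0 w k := by
        rw [hc2, one_mul]
    _ ≤ _ := by linarith

/-- Dissipativity with supply `‖w‖² - s ‖x‖²` bounds the state energy from rest by `s⁻¹` times the
input energy. -/
lemma sum_state_le_of_dissipation {P : Matrix ι ι ℝ} {s : ℝ} (hP : ∀ x, 0 ≤ x ⬝ᵥ P *ᵥ x)
    (hs : ∀ x w, s * (x ⬝ᵥ x) + (A *ᵥ x + B *ᵥ w) ⬝ᵥ P *ᵥ (A *ᵥ x + B *ᵥ w) ≤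
      x ⬝ᵥ P *ᵥ x + w ⬝ᵥ w) (w : ℕ → κ → ℝ) (K : ℕ) :
    s * ∑ k ∈ Finset.range K, stateSeq A B 0 w k ⬝ᵥ stateSeq A B 0 w k ≤
      ∑ k ∈ Finset.range K, w k ⬝ᵥ w k := by
  suffices s * ∑ k ∈ Finset.range K, stateSeq A B 0 w k ⬝ᵥ stateSeq A B 0 w k +
      stateSeq A B 0 w K ⬝ᵥ P *ᵥ stateSeq A B 0 w K ≤ ∑ k ∈ Finset.range K, w k ⬝ᵥ w k by
    linarith [hP (stateSeq A B 0 w K)]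
  induction K with
  | zero => simp [stateSeq]
  | succ K ih =>
    rw [Finset.sum_range_succ, Finset.sum_range_succ, stateSeq]
    linarith [hs (stateSeq A B 0 w K) (w K)]

end Storage

section Gain

variable {ι κ : Type*} [Fintype ι] [Fintype κ] [DecidableEq ι] [DecidableEq κ]

/-- The bounded real lemma, from gain to matrix inequality. -/
lemma exists_posDef_of_gain_lt [Nonempty ι] (A : Matrix ι ι ℝ) (B : Matrix ι κ ℝ)
    {C g γ : ℝ} (hg0 : 0 ≤ g) (hgγ : g < γ)
    (hC : ∀ (x : ℕ → ι → ℝ) (w : ℕ → κ → ℝ), (∀ k, x (k + 1) = A *ᵥ x k + B *ᵥ w k) → ∀ K,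
      ∑ k ∈ Finset.range K, x k ⬝ᵥ x k ≤ C * (x 0 ⬝ᵥ x 0 + ∑ k ∈ Finset.range K, w k ⬝ᵥ w k))
    (hg : ∀ w : ℕ → κ → ℝ, Summable (fun k => w k ⬝ᵥ w k) → ∑' k, w k ⬝ᵥ w k ≤ 1 →
      ∀ K, ∑ k ∈ Finset.range K, stateSeq A B 0 w k ⬝ᵥ stateSeq A B 0 w k ≤ g ^ 2) :
    ∃ P : Matrix ι ι ℝ, P.PosDef ∧
      (fromBlocks P 0 0 (1 : Matrix κ κ ℝ) -
        (fromBlocks A B (1 : Matrix ι ι ℝ) (0 : Matrix ι κ ℝ))ᵀ *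
          fromBlocks P 0 0 ((γ ^ 2)⁻¹ • (1 : Matrix ι ι ℝ)) *
          fromBlocks A B (1 : Matrix ι ι ℝ) (0 : Matrix ι κ ℝ)).PosDef := by
  have hγ : 0 < γ := hg0.trans_lt hgγ
  set σ := g ^ 2 / γ ^ 2 with hσ
  have hσ0 : 0 ≤ σ := by positivity
  have hσ1 : σ < 1 := by
    rw [hσ, div_lt_one (by positivity)]
    gcongr
  set η := (1 - σ) / 7 with hη
  have hη0 : 0 < η := by rw [hη]; linarith
  have hσ7 : σ = 1 - 7 * η := by rw [hη]; ring
  have hq : 0 < (1 + η) / γ ^ 2 := by positivity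
  have hqr : (1 + η) / γ ^ 2 * (1 + η) * g ^ 2 ≤ (1 + η)⁻¹ := by
    have : (1 + η) / γ ^ 2 * (1 + η) * g ^ 2 = (1 + η) * (1 + η) * σ := by
      rw [hσ]; field_simp
    rw [this, ← one_div, le_div_iff₀ (by positivity), hσ7]
    nlinarith [pow_pos hη0 2, pow_pos hη0 3, pow_pos hη0 4]
  obtain ⟨P, hPt, hPlow, hPdiss⟩ := exists_storage_matrix A B hq.le
    (cost_le_of_gain A B hη0 hq.le hC (finite_horizon_gain A B hC hg) hqr)
  have hP : P.PosDef := PosDef.of_dotProduct_mulVec_pos (by simpa [IsHermitian] using hPt)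
    fun x hx => by
      rw [star_trivial]
      exact (mul_pos hq (dotProduct_self_pos hx)).trans_le (hPlow x)
  refine ⟨P, hP, PosDef.of_dotProduct_mulVec_pos ?_ fun v hv => ?_⟩
  · simp [IsHermitian, fromBlocks_transpose, Matrix.mul_assoc, hPt]
  obtain ⟨x, w, rfl⟩ : ∃ x w, v = Sum.elim x w := ⟨v ∘ Sum.inl, v ∘ Sum.inr, by simp⟩
  rw [star_trivial, dotProduct_primal_mulVec]
  have hd := hPdiss x w
  have hx0 : 0 ≤ η / γ ^ 2 * (x ⬝ᵥ x) := mul_nonneg (by positivity) (dotProduct_self_nonneg_real x)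
  have hr : 0 < 1 - (1 + η)⁻¹ := sub_pos.2 (inv_lt_one_of_one_lt₀ (by linarith))
  have hw0 : 0 ≤ (1 - (1 + η)⁻¹) * (w ⬝ᵥ w) := mul_nonneg hr.le (dotProduct_self_nonneg_real w)
  have hsum : 0 < η / γ ^ 2 * (x ⬝ᵥ x) + (1 - (1 + η)⁻¹) * (w ⬝ᵥ w) := by
    by_cases hx : x = 0
    · have hw : w ≠ 0 := by
        rintro rfl
        exact hv (by subst hx; ext (i | i) <;> rfl)
      exact add_pos_of_nonneg_of_pos hx0 (mul_pos hr (dotProduct_self_pos hw))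
    · exact add_pos_of_pos_of_nonneg (mul_pos (by positivity) (dotProduct_self_pos hx)) hw0
  have hqe : (1 + η) / γ ^ 2 * (x ⬝ᵥ x) = (γ ^ 2)⁻¹ * (x ⬝ᵥ x) + η / γ ^ 2 * (x ⬝ᵥ x) := by
    field_simp
  linarith

/-- The bounded real lemma, from matrix inequality to gain. -/
lemma exists_gain_of_posDef (A : Matrix ι ι ℝ) (B : Matrix ι κ ℝ) {γ : ℝ} (hγ : 0 < γ)
    {P : Matrix ι ι ℝ} (hP : P.PosDef)
    (h : (fromBlocks P 0 0 (1 : Matrix κ κ ℝ) -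
        (fromBlocks A B (1 : Matrix ι ι ℝ) (0 : Matrix ι κ ℝ))ᵀ *
          fromBlocks P 0 0 ((γ ^ 2)⁻¹ • (1 : Matrix ι ι ℝ)) *
          fromBlocks A B (1 : Matrix ι ι ℝ) (0 : Matrix ι κ ℝ)).PosDef) :
    ∃ g, 0 ≤ g ∧ g < γ ∧ ∀ (w : ℕ → κ → ℝ) (K : ℕ),
      ∑ k ∈ Finset.range K, stateSeq A B 0 w k ⬝ᵥ stateSeq A B 0 w k ≤
        g ^ 2 * ∑ k ∈ Finset.range K, w k ⬝ᵥ w k := by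
  obtain ⟨ε, hε, hcoer⟩ := exists_forall_mul_dotProduct_le h
  set s := (γ ^ 2)⁻¹ + ε with hs
  have hs0 : 0 < s := by positivity
  refine ⟨Real.sqrt s⁻¹, Real.sqrt_nonneg _, (Real.sqrt_lt' hγ).2 ?_, fun w K => ?_⟩
  · exact inv_lt_of_inv_lt₀ (by positivity) (by linarith)
  rw [Real.sq_sqrt (by positivity), ← div_eq_inv_mul, le_div_iff₀' hs0]
  refine sum_state_le_of_dissipation A B (P := P)
    (fun x => by simpa using hP.posSemidef.dotProduct_mulVec_nonneg x) (fun x v => ?_) w K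
  have hc := hcoer (Sum.elim x v)
  rw [dotProduct_primal_mulVec, sumElim_dotProduct_sumElim] at hc
  have := mul_nonneg hε.le (dotProduct_self_nonneg_real v)
  rw [hs]
  linarith

end Gain

/-- For a Schur-stable `Â` (all complex eigenvalues of modulus `< 1`),
`B ∈ ℝ^{n×m}` and `γ > 0`, the energy-to-energy gain `γ_ee` — the supremum over all
disturbance sequences `w : ℕ → ℝ^m` with `∑ₖ ‖w k‖₂² ≤ 1` of `(∑ₖ ‖x k‖₂²)^{1/2}`, where
`x 0 = 0` and `x (k+1) = Â x k + B (w k)` — satisfies `γ_ee < γ` if and only if there is a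
symmetric positive definite `𝒳` with
`[[𝒳, 0],[0, γ² I]] - [[Â, B],[I, 0]] [[𝒳, 0],[0, I]] [[Â, B],[I, 0]]ᵀ ≻ 0`. -/
theorem stmt_0 (n m : ℕ) (hn : 0 < n) (hm : 0 < m)
    (Ahat : Matrix (Fin n) (Fin n) ℝ) (B : Matrix (Fin n) (Fin m) ℝ)
    (hA : ∀ μ ∈ spectrum ℂ (Ahat.map (algebraMap ℝ ℂ)), ‖μ‖ < 1)
    (γ : ℝ) (hγ : 0 < γ) :
    sSup { e : ℝ | ∃ (w : ℕ → Fin m → ℝ) (x : ℕ → Fin n → ℝ),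
        Summable (fun k => ∑ i, (w k i) ^ 2) ∧ (∑' k, ∑ i, (w k i) ^ 2) ≤ 1 ∧
        x 0 = 0 ∧ (∀ k, x (k + 1) = Ahat.mulVec (x k) + B.mulVec (w k)) ∧
        e = Real.sqrt (∑' k, ∑ i, (x k i) ^ 2) } < γ ↔
    ∃ 𝒳 : Matrix (Fin n) (Fin n) ℝ, 𝒳.PosDef ∧
      (Matrix.fromBlocks 𝒳 0 0 (γ ^ 2 • (1 : Matrix (Fin n) (Fin n) ℝ)) -
        Matrix.fromBlocks Ahat B (1 : Matrix (Fin n) (Fin n) ℝ) (0 : Matrix (Fin n) (Fin m) ℝ) *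
          Matrix.fromBlocks 𝒳 0 0 (1 : Matrix (Fin m) (Fin m) ℝ) *
          (Matrix.fromBlocks Ahat B (1 : Matrix (Fin n) (Fin n) ℝ)
            (0 : Matrix (Fin n) (Fin m) ℝ))ᵀ).PosDef := by
  have hdot : ∀ {l : ℕ} (v : Fin l → ℝ), ∑ i, v i ^ 2 = v ⬝ᵥ v := fun v => by
    simp [dotProduct, sq]
  have : Nonempty (Fin n) := ⟨⟨0, hn⟩⟩
  simp only [hdot]
  set S := { e : ℝ | ∃ (w : ℕ → Fin m → ℝ) (x : ℕ → Fin n → ℝ),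
    Summable (fun k => w k ⬝ᵥ w k) ∧ (∑' k, w k ⬝ᵥ w k) ≤ 1 ∧
    x 0 = 0 ∧ (∀ k, x (k + 1) = Ahat.mulVec (x k) + B.mulVec (w k)) ∧
    e = Real.sqrt (∑' k, x k ⬝ᵥ x k) } with hS
  have hpartial : ∀ {w : ℕ → Fin m → ℝ}, Summable (fun k => w k ⬝ᵥ w k) →
      ∑' k, w k ⬝ᵥ w k ≤ 1 → ∀ K, ∑ k ∈ Finset.range K, w k ⬝ᵥ w k ≤ 1 := fun hw hw1 K =>
    (hw.sum_le_tsum _ fun k _ => dotProduct_self_nonneg_real _).trans hw1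
  constructor
  · intro hlt
    obtain ⟨C, hC0, hC⟩ := exists_energy_bound Ahat B hA
    have hbound : ∀ {w : ℕ → Fin m → ℝ}, Summable (fun k => w k ⬝ᵥ w k) →
        ∑' k, w k ⬝ᵥ w k ≤ 1 → ∀ K,
        ∑ k ∈ Finset.range K, stateSeq Ahat B 0 w k ⬝ᵥ stateSeq Ahat B 0 w k ≤ C :=
      fun {w} hw hw1 K => by
        have h := hC (stateSeq Ahat B 0 w) w (fun _ => rfl) K
        rw [stateSeq, zero_dotProduct, zero_add] at h
        exact h.trans (mul_le_of_le_one_right hC0 (hpartial hw hw1 K))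
    have hbdd : BddAbove S := by
      refine ⟨Real.sqrt C, ?_⟩
      rintro _ ⟨w, x, hw, hw1, hx0, hx, rfl⟩
      rw [eq_stateSeq Ahat B hx, hx0]
      exact Real.sqrt_le_sqrt (Real.tsum_le_of_sum_range_le
        (fun k => dotProduct_self_nonneg_real _) (hbound hw hw1))
    have hg0 : 0 ≤ sSup S := Real.sSup_nonneg (by
      rintro _ ⟨w, x, -, -, -, -, rfl⟩
      exact Real.sqrt_nonneg _)
    obtain ⟨P, hP, hPM⟩ := exists_posDef_of_gain_lt Ahat B hg0 hlt hC fun w hw hw1 K => by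
      have hmem : Real.sqrt (∑' k, stateSeq Ahat B 0 w k ⬝ᵥ stateSeq Ahat B 0 w k) ∈ S :=
        ⟨w, stateSeq Ahat B 0 w, hw, hw1, rfl, fun _ => rfl, rfl⟩
      have hsum : Summable fun k => stateSeq Ahat B 0 w k ⬝ᵥ stateSeq Ahat B 0 w k :=
        summable_of_sum_range_le (fun k => dotProduct_self_nonneg_real _) (hbound hw hw1)
      exact (hsum.sum_le_tsum _ fun k _ => dotProduct_self_nonneg_real _).trans
        (Real.sqrt_le_iff.1 (le_csSup hbdd hmem)).2
    refine ⟨P⁻¹, hP.inv, (posDef_dual_iff_primal Ahat B (by positivity) hP.inv).2 ?_⟩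
    rwa [Matrix.nonsing_inv_nonsing_inv _ ((Matrix.isUnit_iff_isUnit_det _).1 hP.isUnit)]
  · rintro ⟨X, hX, hXM⟩
    obtain ⟨g, hg0, hgγ, hg⟩ := exists_gain_of_posDef Ahat B hγ hX.inv
      ((posDef_dual_iff_primal Ahat B (by positivity) hX).1 hXM)
    refine (Real.sSup_le ?_ hg0).trans_lt hgγ
    rintro _ ⟨w, x, hw, hw1, hx0, hx, rfl⟩
    rw [eq_stateSeq Ahat B hx, hx0]
    refine Real.sqrt_le_iff.2 ⟨hg0, Real.tsum_le_of_sum_range_le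
      (fun k => dotProduct_self_nonneg_real _) fun K => (hg w K).trans ?_⟩
    exact mul_le_of_le_one_right (sq_nonneg g) (hpartial hw hw1 K)
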